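/- Let W be a 4-tensor on ℝ⁵ with curvature symmetries, satisfying the first Bianchi identity, and totally trace-free. Then |Σ_{i,j,k,l,h,m} W_{ijkl} W_{hmij} W_{klhm}| ≤ (4√10/15) · ‖W‖³. -/

import Mathlib

open Finset

/-- A term of a real family with zero sum and squared norm `n (n - 1) t ^ 2` is at most
`(n - 1) t` in absolute value. -/
theorem abs_le_of_sum_eq_zero {ι : Type*} [Fintype ι] [Nonempty ι] (x : ι → ℝ) {t : ℝ}
    (ht : 0 ≤ t) (hsum : ∑ i, x i = 0)
    (hsq : ∑ i, x i ^ 2 = Fintype.card ι * (Fintype.card ι - 1) * t ^ 2) (i : ι) :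
    |x i| ≤ (Fintype.card ι - 1) * t := by
  classical
  have hn : (1 : ℝ) ≤ Fintype.card ι := by exact_mod_cast Fintype.card_pos
  have hcs := sq_sum_le_card_mul_sum_sq (s := univ.erase i) (f := x)
  have h1 := add_sum_erase univ x (mem_univ i)
  have h2 := add_sum_erase univ (fun j => x j ^ 2) (mem_univ i)
  rw [card_erase_of_mem (mem_univ i), card_univ, Nat.cast_pred Fintype.card_pos,
    show ∑ j ∈ univ.erase i, x j = -x i by linarith,
    show ∑ j ∈ univ.erase i, x j ^ 2 =
      Fintype.card ι * (Fintype.card ι - 1) * t ^ 2 - x i ^ 2 by linarith] at hcs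
  refine abs_le_of_sq_le_sq ?_ (mul_nonneg (by linarith) ht)
  nlinarith

/-- Okumura's inequality: a real family with zero sum and squared norm `n (n - 1) t ^ 2` has
sum of cubes at most `n (n - 1) (n - 2) t ^ 3`. -/
theorem sum_cube_le_of_sum_eq_zero {ι : Type*} [Fintype ι] [Nonempty ι] (x : ι → ℝ) {t : ℝ}
    (ht : 0 ≤ t) (hsum : ∑ i, x i = 0)
    (hsq : ∑ i, x i ^ 2 = Fintype.card ι * (Fintype.card ι - 1) * t ^ 2) :
    ∑ i, x i ^ 3 ≤
      Fintype.card ι * (Fintype.card ι - 1) * (Fintype.card ι - 2) * t ^ 3 := by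
  have hpos : 0 ≤ ∑ i, (x i + t) ^ 2 * ((Fintype.card ι - 1) * t - x i) :=
    sum_nonneg fun i _ => mul_nonneg (sq_nonneg _)
      (sub_nonneg.2 ((le_abs_self _).trans (abs_le_of_sum_eq_zero x ht hsum hsq i)))
  have hexp : ∑ i, (x i + t) ^ 2 * ((Fintype.card ι - 1) * t - x i) =
      (Fintype.card ι - 3) * t * ∑ i, x i ^ 2 +
        (2 * Fintype.card ι - 3) * t ^ 2 * ∑ i, x i +
        Fintype.card ι * ((Fintype.card ι - 1) * t ^ 3) - ∑ i, x i ^ 3 := by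
    rw [← nsmul_eq_mul (Fintype.card ι), ← card_univ, ← sum_const, mul_sum, mul_sum,
      ← sum_add_distrib, ← sum_add_distrib, ← sum_sub_distrib]
    exact sum_congr rfl fun i _ => by ring
  rw [hexp, hsum, hsq] at hpos
  linarith

theorem abs_sum_cube_le_of_sum_eq_zero {ι : Type*} [Fintype ι] [Nonempty ι] (x : ι → ℝ) {t : ℝ}
    (ht : 0 ≤ t) (hsum : ∑ i, x i = 0)
    (hsq : ∑ i, x i ^ 2 = Fintype.card ι * (Fintype.card ι - 1) * t ^ 2) :
    |∑ i, x i ^ 3| ≤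
      Fintype.card ι * (Fintype.card ι - 1) * (Fintype.card ι - 2) * t ^ 3 := by
  refine abs_le'.2 ⟨sum_cube_le_of_sum_eq_zero x ht hsum hsq, ?_⟩
  have h := sum_cube_le_of_sum_eq_zero (fun i => -x i) ht (by simp [hsum]) (by simpa using hsq)
  simpa [Odd.neg_pow (by decide : Odd 3)] using h

theorem Matrix.IsHermitian.trace_pow_eq_sum_eigenvalues {n : Type*} [Fintype n] [DecidableEq n]
    {A : Matrix n n ℝ} (hA : A.IsHermitian) (k : ℕ) :
    (A ^ k).trace = ∑ i, hA.eigenvalues i ^ k := by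
  conv_lhs => rw [hA.spectral_theorem, ← map_pow, Matrix.diagonal_pow]
  rw [Unitary.conjStarAlgAut_apply, Matrix.trace_mul_cycle, Unitary.coe_star_mul_self, one_mul,
    Matrix.trace_diagonal]
  simp

theorem Matrix.IsHermitian.abs_trace_pow_three_le {n : Type*} [Fintype n] [DecidableEq n]
    [Nonempty n] {A : Matrix n n ℝ} (hA : A.IsHermitian) {t : ℝ} (ht : 0 ≤ t)
    (htr : A.trace = 0)
    (hsq : (A ^ 2).trace = Fintype.card n * (Fintype.card n - 1) * t ^ 2) :
    |(A ^ 3).trace| ≤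
      Fintype.card n * (Fintype.card n - 1) * (Fintype.card n - 2) * t ^ 3 := by
  rw [hA.trace_pow_eq_sum_eigenvalues] at hsq ⊢
  refine abs_sum_cube_le_of_sum_eq_zero _ ht ?_ hsq
  simpa [htr] using (hA.trace_pow_eq_sum_eigenvalues 1).symm

/-- The standard basis of `Λ²ℝⁿ`. -/
abbrev OrderedPair (n : ℕ) : Type := {p : Fin n × Fin n // p.1 < p.2}

theorem sum_sum_eq_two_mul_sum_orderedPair {n : ℕ} (g : Fin n → Fin n → ℝ)
    (hsymm : ∀ i j, g i j = g j i) (hdiag : ∀ i, g i i = 0) :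
    ∑ i, ∑ j, g i j = 2 * ∑ p : OrderedPair n, g p.1.1 p.1.2 := by
  have hsplit : ∀ i j, g i j = (if i < j then g i j else 0) + if j < i then g j i else 0 := by
    intro i j
    rcases lt_trichotomy i j with h | rfl | h
    · simp [h, h.not_gt]
    · simp [hdiag]
    · simp [h, h.not_gt, hsymm i j]
  have hsub : ∑ p : OrderedPair n, g p.1.1 p.1.2 =
      ∑ i, ∑ j, if i < j then g i j else 0 := by
    rw [← Fintype.sum_prod_type' (fun i j => if i < j then g i j else 0), ← sum_filter]
    exact (sum_subtype _ (by simp) fun p : Fin n × Fin n => g p.1 p.2).symm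
  rw [hsub, two_mul]
  conv_lhs => enter [2, i, 2, j]; rw [hsplit i j]
  simp only [sum_add_distrib]
  congr 1
  exact sum_comm

/-- The action of a curvature-like tensor on `Λ²ℝⁿ`, in the standard basis. -/
def curvatureMatrix {n : ℕ} (W : Fin n → Fin n → Fin n → Fin n → ℝ) :
    Matrix (OrderedPair n) (OrderedPair n) ℝ :=
  Matrix.of fun p q => W p.1.1 p.1.2 q.1.1 q.1.2

theorem isHermitian_curvatureMatrix {n : ℕ} {W : Fin n → Fin n → Fin n → Fin n → ℝ}
    (hpair : ∀ i j k l, W i j k l = W k l i j) : (curvatureMatrix W).IsHermitian :=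
  Matrix.IsHermitian.ext fun _ _ => hpair _ _ _ _

theorem sum_sum_eq_two_mul_trace_curvatureMatrix {n : ℕ}
    {W : Fin n → Fin n → Fin n → Fin n → ℝ}
    (hanti1 : ∀ i j k l, W i j k l = -W j i k l)
    (hanti2 : ∀ i j k l, W i j k l = -W i j l k) :
    ∑ i, ∑ j, W i j i j = 2 * (curvatureMatrix W).trace :=
  sum_sum_eq_two_mul_sum_orderedPair (fun i j => W i j i j)
    (fun i j => by linarith [hanti1 i j i j, hanti2 j i i j])
    (fun i => by linarith [hanti1 i i i i])

theorem sum_sq_eq_four_mul_trace_curvatureMatrix_sq {n : ℕ}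
    {W : Fin n → Fin n → Fin n → Fin n → ℝ}
    (hanti1 : ∀ i j k l, W i j k l = -W j i k l)
    (hanti2 : ∀ i j k l, W i j k l = -W i j l k)
    (hpair : ∀ i j k l, W i j k l = W k l i j) :
    ∑ i, ∑ j, ∑ k, ∑ l, W i j k l ^ 2 = 4 * (curvatureMatrix W ^ 2).trace := by
  have hz1 : ∀ i k l, W i i k l = 0 := fun i k l => by linarith [hanti1 i i k l]
  have hz2 : ∀ i j k, W i j k k = 0 := fun i j k => by linarith [hanti2 i j k k]
  have hinner : ∀ i j, ∑ k, ∑ l, W i j k l ^ 2 =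
      2 * ∑ q : OrderedPair n, W i j q.1.1 q.1.2 ^ 2 := fun i j =>
    sum_sum_eq_two_mul_sum_orderedPair (fun k l => W i j k l ^ 2)
      (fun k l => by rw [hanti2, neg_sq]) (fun k => by simp [hz2])
  simp only [hinner]
  rw [sum_sum_eq_two_mul_sum_orderedPair
      (fun i j => 2 * ∑ q : OrderedPair n, W i j q.1.1 q.1.2 ^ 2)
      (fun i j => by simp only [hanti1 i j, neg_sq]) (fun i => by simp [hz1]),
    ← mul_sum, ← mul_assoc]
  norm_num only
  simp only [Matrix.trace, Matrix.diag_apply, pow_two, Matrix.mul_apply, curvatureMatrix,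
    Matrix.of_apply]
  congr! 3 with p - q -
  rw [hpair q.1.1]

theorem sum_cube_eq_eight_mul_trace_curvatureMatrix_cube {n : ℕ}
    {W : Fin n → Fin n → Fin n → Fin n → ℝ}
    (hanti1 : ∀ i j k l, W i j k l = -W j i k l)
    (hanti2 : ∀ i j k l, W i j k l = -W i j l k) :
    ∑ i, ∑ j, ∑ k, ∑ l, ∑ h, ∑ m, W i j k l * W h m i j * W k l h m =
      8 * (curvatureMatrix W ^ 3).trace := by
  have hz1 : ∀ i k l, W i i k l = 0 := fun i k l => by linarith [hanti1 i i k l]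
  have hz2 : ∀ i j k, W i j k k = 0 := fun i j k => by linarith [hanti2 i j k k]
  have hinner : ∀ i j k l, ∑ h, ∑ m, W i j k l * W h m i j * W k l h m =
      2 * ∑ r : OrderedPair n, W i j k l * W r.1.1 r.1.2 i j * W k l r.1.1 r.1.2 :=
    fun i j k l => sum_sum_eq_two_mul_sum_orderedPair
      (fun h m => W i j k l * W h m i j * W k l h m)
      (fun h m => by rw [hanti1 h m, hanti2 k l h m]; ring) (fun h => by simp [hz2])
  have hmiddle : ∀ i j, ∑ k, ∑ l, 2 * ∑ r : OrderedPair n,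
      W i j k l * W r.1.1 r.1.2 i j * W k l r.1.1 r.1.2 =
      2 * ∑ q : OrderedPair n, 2 * ∑ r : OrderedPair n,
        W i j q.1.1 q.1.2 * W r.1.1 r.1.2 i j * W q.1.1 q.1.2 r.1.1 r.1.2 :=
    fun i j => sum_sum_eq_two_mul_sum_orderedPair
      (fun k l => 2 * ∑ r : OrderedPair n,
        W i j k l * W r.1.1 r.1.2 i j * W k l r.1.1 r.1.2)
      (fun k l => by simp only [hanti2 i j k l, hanti1 k l, neg_mul, mul_neg, neg_neg])
      (fun k => by simp [hz1])
  simp only [hinner, hmiddle]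
  rw [sum_sum_eq_two_mul_sum_orderedPair
      (fun i j => 2 * ∑ q : OrderedPair n, 2 * ∑ r : OrderedPair n,
        W i j q.1.1 q.1.2 * W r.1.1 r.1.2 i j * W q.1.1 q.1.2 r.1.1 r.1.2)
      (fun i j => by simp only [hanti1 i j, hanti2 _ _ i j, neg_mul, mul_neg, neg_neg])
      (fun i => by simp [hz1])]
  simp only [← mul_sum, ← mul_assoc]
  norm_num only
  simp only [Matrix.trace, Matrix.diag_apply, pow_succ', pow_zero, mul_one, Matrix.mul_apply,
    curvatureMatrix, Matrix.of_apply, mul_sum]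
  congr! 4 with p - q - r -
  ring


/-- Case 2 (`n = 5`) in the proof of Lemma 2.4 of the paper:
`|W_{ijkl} W_{hmij} W_{klhm}| ≤ (4√10/15) ‖W‖³` for a totally trace-free
Weyl-type tensor on `ℝ⁵`. -/
theorem stmt_11
    (W : Fin 5 → Fin 5 → Fin 5 → Fin 5 → ℝ)
    (hanti1 : ∀ i j k l, W i j k l = -W j i k l)
    (hanti2 : ∀ i j k l, W i j k l = -W i j l k)
    (hpair : ∀ i j k l, W i j k l = W k l i j)
    (hbianchi : ∀ i j k l, W i j k l + W i k l j + W i l j k = 0)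
    (htrfree : ∀ j l, ∑ i, W i j i l = 0) :
    |∑ i, ∑ j, ∑ k, ∑ l, ∑ h, ∑ m, W i j k l * W h m i j * W k l h m| ≤
      4 * Real.sqrt 10 / 15 *
        (Real.sqrt (∑ i, ∑ j, ∑ k, ∑ l, (W i j k l) ^ 2)) ^ 3 := by
  set A := curvatureMatrix W
  set s := Real.sqrt (∑ i, ∑ j, ∑ k, ∑ l, (W i j k l) ^ 2) with hs
  have hcard : Fintype.card (OrderedPair 5) = 10 := by decide
  have : Nonempty (OrderedPair 5) := Fintype.card_pos_iff.1 (by omega)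
  have h10 : Real.sqrt 10 ^ 2 = 10 := Real.sq_sqrt (by norm_num)
  have hs2 : s ^ 2 = 4 * (A ^ 2).trace := by
    rw [hs, Real.sq_sqrt (by positivity),
      sum_sq_eq_four_mul_trace_curvatureMatrix_sq hanti1 hanti2 hpair]
  have htr : A.trace = 0 := by
    have h := sum_sum_eq_two_mul_trace_curvatureMatrix hanti1 hanti2
    rw [sum_comm, sum_eq_zero fun j _ => htrfree j j] at h
    linarith
  have hA : A.IsHermitian := isHermitian_curvatureMatrix hpair
  have hcube := hA.abs_trace_pow_three_le (t := Real.sqrt 10 / 60 * s) (by positivity) htr (by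
    rw [hcard, mul_pow, div_pow, h10]
    push_cast
    linarith)
  rw [hcard] at hcube
  rw [sum_cube_eq_eight_mul_trace_curvatureMatrix_cube hanti1 hanti2, abs_mul,
    abs_of_pos (by norm_num : (0 : ℝ) < 8)]
  calc 8 * |(A ^ 3).trace|
      ≤ 8 * (((10 : ℕ) : ℝ) * (((10 : ℕ) : ℝ) - 1) * (((10 : ℕ) : ℝ) - 2) *
          (Real.sqrt 10 / 60 * s) ^ 3) := by gcongr
    _ = 4 * Real.sqrt 10 / 15 * s ^ 3 := by
      rw [mul_pow, div_pow, pow_succ (Real.sqrt 10), h10]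
      push_cast
      ring
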